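/- arXiv:alg-geom/9712001 — 4 statements merged into one kernel-verified Lean document; each statement's English description precedes it below -/
import Mathlib

section
/- Let n ≥ 1 and k ≥ 1, let U ⊆ ℂ^k be a nonempty open set, and let φ = (X, Y, Z) : U → (Fin n → ℂ) × (Fin n → ℂ) × ℂ be a holomorphic integral manifold of the contact system. If the derivative fderiv ℂ φ u₀ : ℂ^k → (Fin n → ℂ) × (Fin n → ℂ) × ℂ is injective at some point u₀ ∈ U, then k ≤ n. -/
open Filter Topology Metric Asymptotics

theorem DifferentiableOn.continuousAt_fderiv_complex {E F : Type*} [NormedAddCommGroup E]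
    [NormedSpace ℂ E] [NormedAddCommGroup F] [NormedSpace ℂ F] {f : E → F} {U : Set E} {x : E}
    (hU : U ∈ 𝓝 x) (hf : DifferentiableOn ℂ f U) : ContinuousAt (fderiv ℂ f) x := by
  have hfx : HasFDerivAt f (fderiv ℂ f x) x := (hf.differentiableAt hU).hasFDerivAt
  set L := fderiv ℂ f x
  rw [Metric.continuousAt_iff']
  intro ε hε
  have hlo := (hasFDerivAt_iff_isLittleO.1 hfx).def (show (0 : ℝ) < ε / 8 by positivity)
  obtain ⟨r, hr, hball⟩ := Metric.mem_nhds_iff.1 (inter_mem hU hlo)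
  filter_upwards [ball_mem_nhds x (half_pos hr)] with u hu
  have hsub : ball u (r / 2) ⊆ ball x r := by
    intro w hw
    rw [mem_ball] at *
    linarith [dist_triangle w u x]
  have hbound : ∀ w ∈ ball x r, ‖f w - f x - L (w - x)‖ ≤ ε / 8 * r := fun w hw =>
    ((hball hw).2).trans (by
      have := mem_ball_iff_norm.1 hw
      gcongr)
  have hd : DifferentiableOn ℂ (fun w => f w - L w) (ball u (r / 2)) :=
    (hf.mono (hsub.trans fun w hw => (hball hw).1)).sub L.differentiable.differentiableOn
  have hu' : u ∈ ball u (r / 2) := mem_ball_self (half_pos hr)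
  have key := Complex.norm_fderiv_le_div_of_mapsTo_ball (R₂ := ε / 4 * r) hd (fun w hw => by
    rw [mem_closedBall_iff_norm]
    have h : f w - L w - (f u - L u)
        = (f w - f x - L (w - x)) - (f u - f x - L (u - x)) := by
      simp only [map_sub]; abel
    rw [h]
    refine (norm_sub_le _ _).trans ?_
    linarith [hbound w (hsub hw), hbound u (hsub hu')]) (half_pos hr)
  have hfu : DifferentiableAt ℂ f u :=
    hf.differentiableAt (mem_of_superset (isOpen_ball.mem_nhds (hsub hu'))
      fun w hw => (hball hw).1)
  rw [fderiv_fun_sub hfu L.differentiableAt, L.fderiv] at key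
  rw [dist_eq_norm]
  refine key.trans_lt ?_
  rw [div_lt_iff₀ (half_pos hr)]
  nlinarith

theorem HasFDerivAt.smul_continuousAt_of_eq_zero {𝕜 E F : Type*} [NontriviallyNormedField 𝕜]
    [NormedAddCommGroup E] [NormedSpace 𝕜 E] [NormedAddCommGroup F] [NormedSpace 𝕜 F]
    {c : E → 𝕜} {c' : E →L[𝕜] 𝕜} {g : E → F} {x : E} (hc : HasFDerivAt c c' x)
    (hcx : c x = 0) (hg : ContinuousAt g x) :
    HasFDerivAt (fun u => c u • g u) (c'.smulRight (g x)) x := by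
  rw [hasFDerivAt_iff_isLittleO] at hc ⊢
  have h₁ : (fun u => (c u - c x - c' (u - x)) • g u) =o[𝓝 x] fun u => u - x := by
    have := hc.norm_right.smul_isBigO (hg.tendsto.isBigO_one ℝ)
    simpa using this
  have h₂ : (fun u => c' (u - x) • (g u - g x)) =o[𝓝 x] fun u => u - x := by
    have hg' : (fun u => g u - g x) =o[𝓝 x] fun _ => (1 : ℝ) := by
      rw [isLittleO_one_iff]
      simpa using hg.tendsto.sub_const (g x)
    have := (c'.isBigO_sub (𝓝 x) x).norm_right.smul_isLittleO hg'
    simpa using this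
  refine (h₁.add h₂).congr_left fun u => ?_
  simp only [hcx, ContinuousLinearMap.smulRight_apply]
  module

/-- An isotropic subspace of the standard symplectic space of dimension `2n`, given as the image
of an injective linear map, has dimension at most `n`. -/
theorem finrank_le_card_of_dotProduct_symm {K V ι : Type*} [Field K] [AddCommGroup V] [Module K V]
    [Fintype ι] (A B : V →ₗ[K] ι → K) (hAB : Function.Injective (A.prod B))
    (hsymm : ∀ v w, A v ⬝ᵥ B w = A w ⬝ᵥ B v) : Module.finrank K V ≤ Fintype.card ι := by
  classical
  let β : LinearMap.BilinForm K ((ι → K) × (ι → K)) :=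
    LinearMap.mk₂ K (fun p q => p.1 ⬝ᵥ q.2 - q.1 ⬝ᵥ p.2)
      (by intros; simp [add_dotProduct, dotProduct_add]; ring)
      (by intros; simp [smul_dotProduct, dotProduct_smul]; ring)
      (by intros; simp [add_dotProduct, dotProduct_add]; ring)
      (by intros; simp [smul_dotProduct, dotProduct_smul]; ring)
  have hβ : LinearMap.ker β = ⊥ := by
    refine (Submodule.eq_bot_iff _).2 fun p hp => ?_
    have hp' : ∀ q : (ι → K) × (ι → K), p.1 ⬝ᵥ q.2 - q.1 ⬝ᵥ p.2 = 0 :=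
      LinearMap.congr_fun hp
    ext i
    · simpa using hp' (0, Pi.single i 1)
    · simpa using hp' (Pi.single i 1, 0)
  have hle : LinearMap.range (A.prod B) ≤ β.orthogonal (LinearMap.range (A.prod B)) := by
    rintro _ ⟨v, rfl⟩ _ ⟨w, rfl⟩
    exact sub_eq_zero.2 (hsymm w v)
  have hsum := LinearMap.BilinForm.finrank_add_finrank_orthogonal' (B := β)
    (LinearMap.range (A.prod B))
  have hmono := Submodule.finrank_mono hle
  rw [hβ, inf_bot_eq, finrank_bot, Module.finrank_prod, Module.finrank_fintype_fun_eq_card] at hsum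
  rw [LinearMap.finrank_range_of_inj hAB] at hsum hmono
  lia

/-- The exterior derivative of the contact form vanishes on the tangent spaces of a holomorphic
integral manifold. -/
theorem dotProduct_fderiv_symm_of_integral {E ι : Type*} [NormedAddCommGroup E] [NormedSpace ℂ E]
    [Fintype ι] {U : Set E} (hU : IsOpen U) {X Y : E → ι → ℂ} {Z : E → ℂ}
    (hX : DifferentiableOn ℂ X U) (hY : DifferentiableOn ℂ Y U) (hZ : DifferentiableOn ℂ Z U)
    (hint : ∀ u ∈ U, ∀ v, fderiv ℂ Z u v = ∑ i, X u i * fderiv ℂ Y u v i)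
    {x : E} (hx : x ∈ U) (v w : E) :
    fderiv ℂ X x v ⬝ᵥ fderiv ℂ Y x w = fderiv ℂ X x w ⬝ᵥ fderiv ℂ Y x v := by
  let P (i : ι) : (ι → ℂ) →L[ℂ] ℂ := ContinuousLinearMap.proj i
  have hW : ∀ᶠ u in 𝓝 x, HasFDerivAt (fun u => Z u - ∑ i, X x i * Y u i)
      (∑ i, (X u i - X x i) • (P i).comp (fderiv ℂ Y u)) u := by
    filter_upwards [hU.mem_nhds hx] with u hu
    have hYu := (hY.differentiableAt (hU.mem_nhds hu)).hasFDerivAt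
    have hZu := (hZ.differentiableAt (hU.mem_nhds hu)).hasFDerivAt
    have hsum := HasFDerivAt.fun_sum (u := Finset.univ) fun i _ =>
      ((P i).hasFDerivAt.comp u hYu).const_mul (X x i)
    refine (hZu.sub hsum).congr_fderiv ?_
    ext v
    simp [hint u hu v, P, sub_mul, Finset.sum_sub_distrib]
  have hXx := (hX.differentiableAt (hU.mem_nhds hx)).hasFDerivAt
  have hcont := hY.continuousAt_fderiv_complex (hU.mem_nhds hx)
  have hsnd := HasFDerivAt.fun_sum (u := Finset.univ) fun i _ =>
    (((P i).hasFDerivAt.comp x hXx).sub_const (X x i)).smul_continuousAt_of_eq_zero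
      (g := fun u => (P i).comp (fderiv ℂ Y u)) (by simp [P])
      (continuousAt_const.clm_comp hcont)
  simpa [P, dotProduct] using second_derivative_symmetric_of_eventually hW hsnd v w


/-- If a holomorphic integral manifold of the contact system
`ω = dz − Σ_i x_i dy_i` on `ℂ^{2n+1}` has injective derivative at some point,
then its dimension `k` is at most `n`. -/
theorem stmt_0 (n k : ℕ) (hn : 1 ≤ n) (hk : 1 ≤ k)
    (U : Set (Fin k → ℂ)) (hU : IsOpen U) (hUne : U.Nonempty)
    (X Y : (Fin k → ℂ) → (Fin n → ℂ)) (Z : (Fin k → ℂ) → ℂ)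
    (hX : DifferentiableOn ℂ X U) (hY : DifferentiableOn ℂ Y U)
    (hZ : DifferentiableOn ℂ Z U)
    (hint : ∀ u ∈ U, ∀ v : Fin k → ℂ,
      fderiv ℂ Z u v = ∑ i : Fin n, X u i * fderiv ℂ Y u v i)
    (u₀ : Fin k → ℂ) (hu₀ : u₀ ∈ U)
    (hinj : Function.Injective (fderiv ℂ (fun u => (X u, Y u, Z u)) u₀)) :
    k ≤ n := by
  have hmem := hU.mem_nhds hu₀
  have hXd := (hX.differentiableAt hmem).hasFDerivAt
  have hYd := (hY.differentiableAt hmem).hasFDerivAt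
  have hZd := (hZ.differentiableAt hmem).hasFDerivAt
  rw [(hXd.prodMk (hYd.prodMk hZd)).fderiv] at hinj
  have hle := finrank_le_card_of_dotProduct_symm (fderiv ℂ X u₀ : (Fin k → ℂ) →ₗ[ℂ] Fin n → ℂ)
    (fderiv ℂ Y u₀ : (Fin k → ℂ) →ₗ[ℂ] Fin n → ℂ) (fun v w hvw => by
      simp only [LinearMap.prod_apply, Function.prod_apply, ContinuousLinearMap.coe_coe,
        Prod.mk.injEq] at hvw
      apply hinj
      simp [hvw.1, hvw.2, hint u₀ hu₀])
    fun v w => dotProduct_fderiv_symm_of_integral hU hX hY hZ hint hu₀ v w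
  simpa using hle
end

section
/- Let n, k ≥ 1, let U ⊆ ℂ^k be open, let φ = (X, Y, Z) : U → (Fin n → ℂ) × (Fin n → ℂ) × ℂ be a holomorphic integral manifold of the contact system whose derivative fderiv ℂ φ u is injective at every u ∈ U, and let s ∈ U. Then there exist disjoint subsets I, J ⊆ Fin n with |I| + |J| = k such that the holomorphic map U → (I → ℂ) × (J → ℂ), u ↦ ((X_i(u))_{i ∈ I}, (Y_j(u))_{j ∈ J}), has bijective derivative at s (its derivative is a ℂ-linear isomorphism from ℂ^k onto (I → ℂ) × (J → ℂ)); i.e., the variables x_i (i ∈ I) and y_j (j ∈ J) are independent coordinates on the integral manifold near s. -/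
open Metric in
/-- The derivative of a holomorphic function is locally bounded (Cauchy estimate). -/
theorem exists_norm_fderiv_le_of_differentiableOn {E : Type*} [NormedAddCommGroup E]
    [NormedSpace ℂ E] {f : E → ℂ} {U : Set E} (hU : IsOpen U) (hf : DifferentiableOn ℂ f U)
    {s : E} (hs : s ∈ U) :
    ∃ r > 0, ball s r ⊆ U ∧ ∃ C : ℝ, ∀ u ∈ ball s r, ‖fderiv ℂ f u‖ ≤ C := by
  have hc : ∀ᶠ u in nhds s, ‖f u‖ < ‖f s‖ + 1 :=
    (hf.differentiableAt (hU.mem_nhds hs)).continuousAt.norm.eventually_lt_const (by linarith)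
  obtain ⟨R, hR, hball⟩ := Metric.mem_nhds_iff.1 (hc.and (hU.mem_nhds hs))
  refine ⟨R / 2, by positivity, fun u hu => (hball (ball_subset_ball (by linarith) hu)).2,
    (‖f s‖ + 1) / (R / 4), fun u hu => ?_⟩
  refine ContinuousLinearMap.opNorm_le_bound _ (by positivity) fun v => ?_
  rcases eq_or_ne v 0 with rfl | hv
  · simp
  have hv' : 0 < ‖v‖ := norm_pos_iff.2 hv
  set ρ : ℝ := R / 4 / ‖v‖ with hρ
  have hρ0 : 0 < ρ := by positivity
  have hmem : ∀ z ∈ closedBall (0 : ℂ) ρ, u + z • v ∈ ball s R := by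
    intro z hz
    rw [mem_closedBall_zero_iff] at hz
    have h1 : ‖z • v‖ ≤ R / 4 := by
      rw [norm_smul]
      calc ‖z‖ * ‖v‖ ≤ ρ * ‖v‖ := by gcongr
        _ = R / 4 := by rw [hρ]; field_simp
    rw [mem_ball, dist_eq_norm] at hu ⊢
    calc ‖u + z • v - s‖ = ‖(u - s) + z • v‖ := by congr 1; abel
      _ ≤ ‖u - s‖ + ‖z • v‖ := norm_add_le _ _
      _ < R := by linarith
  have hd : ∀ z ∈ closedBall (0 : ℂ) ρ,
      HasDerivAt (fun z : ℂ => f (u + z • v)) (fderiv ℂ f (u + z • v) v) z := by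
    intro z hz
    have h1 : HasDerivAt (fun z : ℂ => u + z • v) v z := by
      simpa using ((hasDerivAt_id z).smul_const v).const_add u
    exact (hf.differentiableAt
      (hU.mem_nhds (hball (hmem z hz)).2)).hasFDerivAt.comp_hasDerivAt z h1
  have key := Complex.norm_deriv_le_of_forall_mem_sphere_norm_le (c := 0) (C := ‖f s‖ + 1) hρ0
    (f := fun z : ℂ => f (u + z • v))
    (DifferentiableOn.diffContOnCl_ball (U := closedBall 0 ρ)
      (fun z hz => (hd z hz).differentiableAt.differentiableWithinAt) subset_rfl)
    (fun z hz => (hball (hmem z (sphere_subset_closedBall hz))).1.le)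
  rw [(hd 0 (by simpa using hρ0.le)).deriv] at key
  simp only [zero_smul, add_zero] at key
  calc ‖fderiv ℂ f u v‖ ≤ (‖f s‖ + 1) / ρ := key
    _ = (‖f s‖ + 1) / (R / 4) * ‖v‖ := by rw [hρ]; field_simp

open Metric Real in
/-- The directional derivatives of a holomorphic function of several variables are holomorphic:
differentiate the Cauchy integral formula along the direction `v` under the integral sign. -/
theorem differentiableAt_fderiv_apply_const_of_differentiableOn {E : Type*} [NormedAddCommGroup E]
    [NormedSpace ℂ E] [FiniteDimensional ℂ E] {f : E → ℂ} {U : Set E} (hU : IsOpen U)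
    (hf : DifferentiableOn ℂ f U) {s : E} (hs : s ∈ U) (v : E) :
    DifferentiableAt ℂ (fun u => fderiv ℂ f u v) s := by
  obtain ⟨r, hr, hrU, C, hC⟩ := exists_norm_fderiv_le_of_differentiableOn hU hf hs
  set ρ : ℝ := r / 2 / (‖v‖ + 1) with hρ
  have hρ0 : 0 < ρ := by positivity
  have hmem : ∀ u ∈ ball s (r / 2), ∀ z ∈ closedBall (0 : ℂ) ρ, u + z • v ∈ ball s r := by
    intro u hu z hz
    rw [mem_closedBall_zero_iff] at hz
    have h1 : ‖z • v‖ ≤ r / 2 := by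
      rw [norm_smul]
      calc ‖z‖ * ‖v‖ ≤ ρ * (‖v‖ + 1) := by gcongr; linarith
        _ = r / 2 := by rw [hρ]; field_simp
    rw [mem_ball, dist_eq_norm] at hu ⊢
    calc ‖u + z • v - s‖ = ‖(u - s) + z • v‖ := by congr 1; abel
      _ ≤ ‖u - s‖ + ‖z • v‖ := norm_add_le _ _
      _ < r := by linarith
  have hcirc : ∀ θ, circleMap 0 ρ θ ∈ closedBall (0 : ℂ) ρ := fun θ =>
    circleMap_mem_closedBall 0 hρ0.le θ
  have hdf : ∀ u ∈ ball s r, DifferentiableAt ℂ f u := fun u hu =>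
    hf.differentiableAt (hU.mem_nhds (hrU hu))
  let c : ℝ → ℂ := fun θ => deriv (circleMap 0 ρ) θ * ((circleMap 0 ρ θ - 0) ^ 2)⁻¹
  have hc : Continuous c := by
    have h0 : ∀ θ, (circleMap 0 ρ θ - 0) ^ 2 ≠ 0 := fun θ => by simp [hρ0.ne']
    simp only [c, deriv_circleMap]
    fun_prop (disch := exact h0 _)
  have hcauchy : ∀ u ∈ ball s (r / 2), fderiv ℂ f u v =
      (2 * π * Complex.I : ℂ)⁻¹ • ∫ θ in (0 : ℝ)..2 * π, c θ * f (u + circleMap 0 ρ θ • v) := by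
    intro u hu
    have hline : ∀ z : ℂ, HasDerivAt (fun z : ℂ => u + z • v) v z := fun z => by
      simpa using ((hasDerivAt_id z).smul_const v).const_add u
    have hopen : IsOpen ((fun z : ℂ => u + z • v) ⁻¹' ball s r) :=
      isOpen_ball.preimage (by fun_prop)
    have h := Complex.cderiv_eq_deriv (z := 0) (f := fun z : ℂ => f (u + z • v)) hopen
      (fun z hz => ((hdf _ hz).comp z (hline z).differentiableAt).differentiableWithinAt)
      hρ0 (fun z hz => hmem u hu z hz)
    have hu' : u + (0 : ℂ) • v ∈ ball s r := hmem u hu 0 (by simpa using hρ0.le)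
    have h' : deriv (fun z : ℂ => f (u + z • v)) 0 = fderiv ℂ f u v := by
      have := ((hdf _ hu').hasFDerivAt.comp_hasDerivAt 0 (hline 0)).deriv
      simpa [Function.comp_def] using this
    rw [← h', ← h, Complex.cderiv, circleIntegral]
    simp only [smul_eq_mul, c, mul_assoc]
  have hcont : ∀ u ∈ ball s (r / 2), Continuous fun θ => c θ * f (u + circleMap 0 ρ θ • v) := by
    intro u hu
    refine hc.mul (continuous_iff_continuousAt.2 fun θ => ?_)
    exact ContinuousAt.comp (f := fun θ => u + circleMap 0 ρ θ • v)
      (hdf _ (hmem u hu _ (hcirc θ))).continuousAt (by fun_prop)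
  have hs' : s ∈ ball s (r / 2) := mem_ball_self (by positivity)
  have hnhds : ball s (r / 2) ∈ nhds s := ball_mem_nhds s (by positivity)
  have hint : DifferentiableAt ℂ
      (fun u => ∫ θ in (0 : ℝ)..2 * π, c θ * f (u + circleMap 0 ρ θ • v)) s := by
    refine (intervalIntegral.hasFDerivAt_integral_of_dominated_of_fderiv_le
      (F := fun u θ => c θ * f (u + circleMap 0 ρ θ • v))
      (F' := fun u θ => c θ • fderiv ℂ f (u + circleMap 0 ρ θ • v))
      (bound := fun θ => ‖c θ‖ * C) hnhds ?_ ?_ ?_ ?_ ?_ ?_).differentiableAt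
    · filter_upwards [hnhds] with u hu using (hcont u hu).aestronglyMeasurable
    · exact (hcont s hs').intervalIntegrable _ _
    · borelize E
      borelize (E →L[ℂ] ℂ)
      have : ProperSpace E := FiniteDimensional.proper ℂ E
      have : ProperSpace (E →L[ℂ] ℂ) := FiniteDimensional.proper ℂ _
      refine hc.aestronglyMeasurable.smul (Measurable.aestronglyMeasurable ?_)
      exact (measurable_fderiv ℂ f).comp (Continuous.measurable (by fun_prop))
    · refine Filter.Eventually.of_forall fun θ _ u hu => ?_
      rw [norm_smul]
      gcongr
      exact hC _ (hmem u hu _ (hcirc θ))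
    · exact (hc.norm.mul continuous_const).intervalIntegrable _ _
    · refine Filter.Eventually.of_forall fun θ _ u hu => ?_
      exact ((hasFDerivAt_comp_add_right (circleMap 0 ρ θ • v)).2
        (hdf _ (hmem u hu _ (hcirc θ))).hasFDerivAt).const_mul (c θ)
  refine (hint.const_smul ((2 * π * Complex.I : ℂ)⁻¹)).congr_of_eventuallyEq ?_
  filter_upwards [hnhds] with u hu using hcauchy u hu

/-- The derivative of a holomorphic function of several variables is holomorphic. -/
theorem differentiableAt_fderiv_of_differentiableOn {E : Type*}
    [NormedAddCommGroup E] [NormedSpace ℂ E] [FiniteDimensional ℂ E] {f : E → ℂ} {U : Set E}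
    (hU : IsOpen U) (hf : DifferentiableOn ℂ f U) {s : E} (hs : s ∈ U) :
    DifferentiableAt ℂ (fderiv ℂ f) s := by
  let b := Module.finBasis ℂ E
  have h : fderiv ℂ f = fun u => ∑ i, fderiv ℂ f u (b i) • (b.coord i).toContinuousLinearMap := by
    ext u v
    rw [← congrArg (fderiv ℂ f u) (b.sum_repr v)]
    simp only [map_sum, map_smul]
    simp [mul_comm]
  rw [h]
  have := fun i => differentiableAt_fderiv_apply_const_of_differentiableOn hU hf hs (b i)
  fun_prop

/-- A linear embedding `(A, B)` with isotropic image in a symplectic space restricts to an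
isomorphism onto some coordinate subspace containing no pair of conjugate coordinates. -/
theorem exists_disjoint_bijective_of_isotropic {n : ℕ} {V : Type*} [AddCommGroup V] [Module ℂ V]
    [FiniteDimensional ℂ V] (A B : Fin n → Module.Dual ℂ V)
    (hiso : ∀ v w, ∑ i, (A i v * B i w - A i w * B i v) = 0)
    (hinj : ∀ v, (∀ i, A i v = 0) → (∀ i, B i v = 0) → v = 0) :
    ∃ I J : Finset (Fin n), Disjoint I J ∧ I.card + J.card = Module.finrank ℂ V ∧
      Function.Bijective fun v =>
        ((fun i : {i // i ∈ I} => A i.1 v), (fun j : {j // j ∈ J} => B j.1 v)) := by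
  classical
  obtain ⟨I, -, -, hspan, hI⟩ := exists_linearIndepOn_extension (K := ℂ) (v := A)
    (linearIndepOn_empty ℂ A) (Set.empty_subset Set.univ)
  have hann : ∀ (ι : Type) (C : ι → Module.Dual ℂ V) (b t : Set ι) (v : V),
      C '' t ⊆ Submodule.span ℂ (C '' b) → (∀ i ∈ b, C i v = 0) → ∀ i ∈ t, C i v = 0 := by
    intro ι C b t v hsub hb i hi
    have hle : Submodule.span ℂ (C '' b) ≤ LinearMap.ker (Module.Dual.eval ℂ V v) := by
      rw [Submodule.span_le]
      rintro _ ⟨j, hj, rfl⟩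
      exact hb j hj
    exact hle (hsub ⟨i, hi, rfl⟩)
  have hzero : ∀ v, (∀ i ∈ I, A i v = 0) → (∀ j ∉ I, B j v = 0) → v = 0 := by
    intro v hA hB
    have hA' : ∀ i, A i v = 0 := fun i => hann _ A I Set.univ v hspan hA i trivial
    refine hinj v hA' fun i => ?_
    by_cases hi : i ∈ I
    · refine linearIndepOn_iff'.1 hI I.toFinset (fun i => B i v) (by simp) ?_ i (by simpa using hi)
      ext w
      have h := hiso w v
      simp only [hA', zero_mul, sub_zero] at h
      rw [← Finset.sum_subset (Finset.subset_univ I.toFinset)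
        (fun j _ hj => by rw [hB j (by simpa using hj), mul_zero])] at h
      simpa [LinearMap.sum_apply, mul_comm] using h
    · exact hB i hi
  let C : Fin n ⊕ Fin n → Module.Dual ℂ V := Sum.elim A B
  have hCI : LinearIndepOn ℂ C (Sum.inl '' I) :=
    LinearIndepOn.image_of_comp Sum.inl C hI
  obtain ⟨b, hbt, hIb, hspan', hb⟩ := exists_linearIndepOn_extension hCI
    (Set.subset_union_left (t := Sum.inr '' Iᶜ))
  have hbl : ∀ i, Sum.inl i ∈ b ↔ i ∈ I := fun i =>
    ⟨fun h => by simpa using hbt h, fun h => hIb ⟨i, h, rfl⟩⟩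
  have hbr : ∀ i, Sum.inr i ∈ b → i ∉ I := fun i h => by simpa using hbt h
  have hzero' : ∀ v, (∀ i ∈ b, C i v = 0) → v = 0 := by
    intro v hv
    have h := hann _ C b _ v hspan' hv
    exact hzero v (fun i hi => h (.inl i) (.inl ⟨i, hi, rfl⟩))
      (fun j hj => h (.inr j) (.inr ⟨j, hj, rfl⟩))
  let I' : Finset (Fin n) := Finset.univ.filter fun i => Sum.inl i ∈ b
  let J' : Finset (Fin n) := Finset.univ.filter fun i => Sum.inr i ∈ b
  have hcard : I'.card + J'.card ≤ Module.finrank ℂ V := by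
    have h := LinearIndependent.fintype_card_le_finrank hb
    rw [Subspace.dual_finrank_eq, ← Set.toFinset_card] at h
    rw [← Finset.card_disjSum]
    refine le_of_eq_of_le (congrArg _ ?_) h
    ext (i | i) <;> simp [I', J']
  let L : V →ₗ[ℂ] ({i // i ∈ I'} → ℂ) × ({j // j ∈ J'} → ℂ) :=
    (LinearMap.pi fun i => A i.1).prod (LinearMap.pi fun j => B j.1)
  have hL : Function.Injective L := by
    rw [injective_iff_map_eq_zero]
    intro v hv
    refine hzero' v ?_
    rintro (i | j) hij
    · exact congrFun (congrArg Prod.fst hv) ⟨i, by simpa [I'] using hij⟩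
    · exact congrFun (congrArg Prod.snd hv) ⟨j, by simpa [J'] using hij⟩
  have hrank : Module.finrank ℂ (({i // i ∈ I'} → ℂ) × ({j // j ∈ J'} → ℂ)) =
      I'.card + J'.card := by simp
  have heq : I'.card + J'.card = Module.finrank ℂ V :=
    hcard.antisymm (hrank ▸ LinearMap.finrank_le_finrank_of_injective hL)
  refine ⟨I', J', ?_, heq, hL, ?_⟩
  · rw [Finset.disjoint_left]
    intro i hi hj
    exact hbr i (by simpa [J'] using hj) ((hbl i).1 (by simpa [I'] using hi))
  · exact (LinearMap.injective_iff_surjective_of_finrank_eq_finrank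
      (heq.symm.trans hrank.symm)).1 hL

/-- Differentiating `dZ = ∑ i, X i • dY i` gives `∑ i, dX i ∧ dY i = 0`. -/
theorem isotropic_fderiv_of_fderiv_eq_sum {n : ℕ} {E : Type*} [NormedAddCommGroup E]
    [NormedSpace ℂ E] [FiniteDimensional ℂ E] {U : Set E} (hU : IsOpen U)
    {X Y : Fin n → E → ℂ} {Z : E → ℂ} (hX : ∀ i, DifferentiableOn ℂ (X i) U)
    (hY : ∀ i, DifferentiableOn ℂ (Y i) U) (hZ : DifferentiableOn ℂ Z U)
    (hint : ∀ u ∈ U, fderiv ℂ Z u = ∑ i, X i u • fderiv ℂ (Y i) u) {s : E} (hs : s ∈ U) (v w : E) :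
    ∑ i, (fderiv ℂ (X i) s v * fderiv ℂ (Y i) s w -
      fderiv ℂ (X i) s w * fderiv ℂ (Y i) s v) = 0 := by
  have hnhds := hU.mem_nhds hs
  have hsymm : ∀ f : E → ℂ, DifferentiableOn ℂ f U → ∀ f'',
      HasFDerivAt (fderiv ℂ f) f'' s → f'' v w = f'' w v := fun f hf f'' h =>
    second_derivative_symmetric_of_eventually
      (Filter.eventually_of_mem hnhds fun u hu =>
        (hf.differentiableAt (hU.mem_nhds hu)).hasFDerivAt) h v w
  have hYY : ∀ i, HasFDerivAt (fderiv ℂ (Y i)) (fderiv ℂ (fderiv ℂ (Y i)) s) s := fun i =>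
    (differentiableAt_fderiv_of_differentiableOn hU (hY i) hs).hasFDerivAt
  have hZZ := (HasFDerivAt.fun_sum (u := Finset.univ) fun i _ =>
    ((hX i).differentiableAt hnhds).hasFDerivAt.smul (hYY i)).congr_of_eventuallyEq
      (Filter.eventually_of_mem hnhds hint)
  have h := hsymm Z hZ _ hZZ
  have hYs := fun i => hsymm (Y i) (hY i) _ (hYY i)
  simp only [sum_apply, add_apply, smul_apply, ContinuousLinearMap.smulRight_apply,
    smul_eq_mul, hYs, Finset.sum_add_distrib] at h
  rw [Finset.sum_sub_distrib, sub_eq_zero]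
  exact add_left_cancel h

/-- On a `k`-dimensional holomorphic integral manifold of the contact system there
exist disjoint index sets `I, J` of total cardinality `k` such that the variables
`x_i (i ∈ I)` and `y_j (j ∈ J)` are independent coordinates near `s`. -/
theorem stmt_1 (n k : ℕ) (hn : 1 ≤ n) (hk : 1 ≤ k)
    (U : Set (Fin k → ℂ)) (hU : IsOpen U)
    (X Y : (Fin k → ℂ) → (Fin n → ℂ)) (Z : (Fin k → ℂ) → ℂ)
    (hX : DifferentiableOn ℂ X U) (hY : DifferentiableOn ℂ Y U)
    (hZ : DifferentiableOn ℂ Z U)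
    (hint : ∀ u ∈ U, ∀ v : Fin k → ℂ,
      fderiv ℂ Z u v = ∑ i : Fin n, X u i * fderiv ℂ Y u v i)
    (hinj : ∀ u ∈ U, Function.Injective (fderiv ℂ (fun u => (X u, Y u, Z u)) u))
    (s : Fin k → ℂ) (hs : s ∈ U) :
    ∃ I J : Finset (Fin n), Disjoint I J ∧ I.card + J.card = k ∧
      Function.Bijective
        (fderiv ℂ
          (fun u => ((fun i : {i // i ∈ I} => X u i.1), (fun j : {j // j ∈ J} => Y u j.1)))
          s) := by
  have hXi : ∀ i, DifferentiableOn ℂ (fun u => X u i) U := differentiableOn_pi.1 hX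
  have hYi : ∀ i, DifferentiableOn ℂ (fun u => Y u i) U := differentiableOn_pi.1 hY
  have hXs : ∀ i, DifferentiableAt ℂ (fun u => X u i) s := fun i =>
    (hXi i).differentiableAt (hU.mem_nhds hs)
  have hYs : ∀ i, DifferentiableAt ℂ (fun u => Y u i) s := fun i =>
    (hYi i).differentiableAt (hU.mem_nhds hs)
  have hXd := hX.differentiableAt (hU.mem_nhds hs)
  have hYd := hY.differentiableAt (hU.mem_nhds hs)
  have hZd := hZ.differentiableAt (hU.mem_nhds hs)
  have hiso := isotropic_fderiv_of_fderiv_eq_sum hU hXi hYi hZ (fun u hu => by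
    ext1 v
    simp only [hint u hu v, sum_apply, smul_apply, smul_eq_mul]
    refine Finset.sum_congr rfl fun i _ => ?_
    rw [fderiv_pi fun i => (hYi i).differentiableAt (hU.mem_nhds hu)]
    rfl) hs
  obtain ⟨I, J, hIJ, hcard, hbij⟩ := exists_disjoint_bijective_of_isotropic
    (fun i => (fderiv ℂ (fun u => X u i) s).toLinearMap)
    (fun i => (fderiv ℂ (fun u => Y u i) s).toLinearMap) hiso (fun v hA hB => by
      have hXv : fderiv ℂ X s v = 0 := by
        rw [fderiv_pi hXs]
        exact funext hA
      have hYv : fderiv ℂ Y s v = 0 := by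
        rw [fderiv_pi hYs]
        exact funext hB
      refine (injective_iff_map_eq_zero _).1 (hinj s hs) v ?_
      rw [hXd.fderiv_prodMk (hYd.prodMk hZd), hYd.fderiv_prodMk hZd]
      simp [hXv, hYv, hint s hs v])
  refine ⟨I, J, hIJ, by simpa using hcard, ?_⟩
  have hXI : ∀ i : {i // i ∈ I}, DifferentiableAt ℂ (fun u => X u i.1) s := fun i => hXs i.1
  have hYJ : ∀ j : {j // j ∈ J}, DifferentiableAt ℂ (fun u => Y u j.1) s := fun j => hYs j.1
  rw [(differentiableAt_pi.2 hXI).fderiv_prodMk (differentiableAt_pi.2 hYJ), fderiv_pi hXI,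
    fderiv_pi hYJ]
  exact hbij
end

section
/- Let w ≥ 2, let m : Fin (w+1) → ℕ, let d ≥ 1, and let U ⊆ ℂ^d be an open convex set containing 0. Suppose given holomorphic (ℂ-differentiable) maps Y¹_j : U → Matrix (Fin (m (j+1))) (Fin (m j)) ℂ for 0 ≤ j ≤ w−1 and Y²_j : U → Matrix (Fin (m (j+2))) (Fin (m j)) ℂ for 0 ≤ j ≤ w−2, satisfying the coupled contact equations: for all u ∈ U, v ∈ ℂ^d and 0 ≤ j ≤ w−2, fderiv ℂ Y²_j u v = Y¹_{j+1}(u) * (fderiv ℂ Y¹_j u v). Then there exists a UNIQUE family of holomorphic maps Y_{i,j} : U → Matrix (Fin (m i)) (Fin (m j)) ℂ, indexed by pairs 0 ≤ j < i ≤ w with i − j ≥ 3, such that Y_{i,j}(0) = 0 for all such (i, j) and, for all such (i, j), all u ∈ U and v ∈ ℂ^d: fderiv ℂ Y_{i,j} u v = Z_{i,j+1}(u) * (fderiv ℂ Y¹_j u v), where Z_{i,j+1} := Y²_{j+1} if i − j = 3 and Z_{i,j+1} := Y_{i,j+1} (a member of the family) if i − j ≥ 4. (Hence every germ of an integral manifold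 of the coupled contact system extends uniquely to a germ of an integral manifold of Griffiths' horizontal differential system.) -/
attribute [local instance] Matrix.normedAddCommGroup Matrix.normedSpace

/-- The property that the family `Yf = (Y_{i,j})_{i−j ≥ 3}` of holomorphic maps on `U`,
vanishing at `0`, solves the equations `dY_{i,j} = Y_{i,j+1} dY_{j+1,j}` of Griffiths'
horizontal system, given a solution `(Y1, Y2)` of the coupled contact system
(`Y1 j = Y_{j+1,j}`, `Y2 j = Y_{j+2,j}`, weight `w = W + 2`). -/
def IsHorizontalExtension (W : ℕ) (m : ℕ → ℕ) {d : ℕ} (U : Set (Fin d → ℂ))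
    (Y1 : (j : Fin (W + 2)) → (Fin d → ℂ) → Matrix (Fin (m ((j : ℕ) + 1))) (Fin (m (j : ℕ))) ℂ)
    (Y2 : (j : Fin (W + 1)) → (Fin d → ℂ) → Matrix (Fin (m ((j : ℕ) + 2))) (Fin (m (j : ℕ))) ℂ)
    (Yf : (i j : ℕ) → j + 3 ≤ i → i ≤ W + 2 → (Fin d → ℂ) → Matrix (Fin (m i)) (Fin (m j)) ℂ) :
    Prop :=
  (∀ i j h1 h2, DifferentiableOn ℂ (Yf i j h1 h2) U) ∧
  (∀ i j h1 h2, Yf i j h1 h2 0 = 0) ∧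
  (∀ (j : ℕ) (h : j + 3 ≤ W + 2), ∀ u ∈ U, ∀ v : Fin d → ℂ,
    fderiv ℂ (Yf (j + 3) j le_rfl h) u v =
      Y2 ⟨j + 1, by omega⟩ u * fderiv ℂ (Y1 ⟨j, by omega⟩) u v) ∧
  (∀ (i j : ℕ) (h1 : j + 4 ≤ i) (h2 : i ≤ W + 2), ∀ u ∈ U, ∀ v : Fin d → ℂ,
    fderiv ℂ (Yf i j (by omega) h2) u v =
      Yf i (j + 1) (by omega) h2 u * fderiv ℂ (Y1 ⟨j, by omega⟩) u v)

section Holomorphic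

open Metric MeasureTheory Set Topology

variable {E F G H : Type*} [NormedAddCommGroup E] [NormedSpace ℂ E]
  [NormedAddCommGroup F] [NormedSpace ℂ F]
  [NormedAddCommGroup G] [NormedSpace ℂ G] [NormedAddCommGroup H] [NormedSpace ℂ H]

/-- Cauchy's formula for the directional derivative of a holomorphic map. -/
theorem fderiv_apply_eq_cderiv [CompleteSpace F] {f : E → F} {U : Set E} (hU : IsOpen U)
    (hf : DifferentiableOn ℂ f U) {x v : E} {r : ℝ} (hr : 0 < r)
    (hmem : ∀ z ∈ closedBall (0 : ℂ) r, x + z • v ∈ U) :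
    fderiv ℂ f x v = Complex.cderiv r (fun z : ℂ ↦ f (x + z • v)) 0 := by
  have hl : Differentiable ℂ fun z : ℂ ↦ x + z • v := by fun_prop
  rw [Complex.cderiv_eq_deriv (f := fun z : ℂ ↦ f (x + z • v)) (hU.preimage hl.continuous)
    (hf.comp hl.differentiableOn fun _ hz ↦ hz) hr hmem]
  have hx : x ∈ U := by simpa using hmem 0 (by simp [hr.le])
  have h1 : HasDerivAt (fun z : ℂ ↦ x + z • v) v 0 := by
    simpa using ((hasDerivAt_id (0 : ℂ)).smul_const v).const_add x
  have h2 : HasFDerivAt f (fderiv ℂ f x) (x + (0 : ℂ) • v) := by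
    simpa using (hf.differentiableAt (hU.mem_nhds hx)).hasFDerivAt
  exact (h2.comp_hasDerivAt (0 : ℂ) h1).deriv.symm

/-- The Fréchet derivative of a holomorphic map is locally bounded. -/
theorem exists_ball_norm_fderiv_le_of_differentiableOn {f : E → F} {U : Set E} (hU : IsOpen U)
    (hf : DifferentiableOn ℂ f U) {x : E} (hx : x ∈ U) :
    ∃ R > 0, ball x R ⊆ U ∧ ∃ C, ∀ y ∈ ball x R, ‖fderiv ℂ f y‖ ≤ C := by
  have hc : ContinuousAt f x := (hf.differentiableAt (hU.mem_nhds hx)).continuousAt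
  obtain ⟨R, hR, hRU⟩ := Metric.mem_nhds_iff.1
    (Filter.inter_mem (hU.mem_nhds hx) (hc.preimage_mem_nhds (ball_mem_nhds _ one_pos)))
  refine ⟨R / 2, by positivity, fun y hy ↦ (hRU (ball_subset_ball (by linarith) hy)).1,
    2 / (R / 2), fun y hy ↦ ?_⟩
  have hsub : ball y (R / 2) ⊆ ball x R := by
    apply ball_subset_ball'
    rw [mem_ball] at hy
    linarith
  refine Complex.norm_fderiv_le_div_of_mapsTo_ball
    (hf.mono fun z hz ↦ (hRU (hsub hz)).1) (fun z hz ↦ ?_) (by positivity)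
  have h1 : dist (f z) (f x) < 1 := (hRU (hsub hz)).2
  have h2 : dist (f y) (f x) < 1 := (hRU (hsub (mem_ball_self (by positivity)))).2
  rw [mem_closedBall]
  linarith [dist_triangle_right (f z) (f y) (f x)]

/-- Directional derivatives of a holomorphic map in several variables are holomorphic. -/
theorem differentiableOn_fderiv_apply [FiniteDimensional ℂ E] [FiniteDimensional ℂ F]
    {f : E → F} {U : Set E} (hU : IsOpen U) (hf : DifferentiableOn ℂ f U) (v : E) :
    DifferentiableOn ℂ (fun u ↦ fderiv ℂ f u v) U := by
  have : CompleteSpace F := FiniteDimensional.complete ℂ F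
  have : ProperSpace E := FiniteDimensional.proper ℂ E
  have : ProperSpace F := FiniteDimensional.proper ℂ F
  intro x hx
  apply DifferentiableAt.differentiableWithinAt
  obtain ⟨R, hR, hRU, C, hC⟩ := exists_ball_norm_fderiv_le_of_differentiableOn hU hf hx
  set r : ℝ := R / 2 / (‖v‖ + 1) with hr_def
  have hr : 0 < r := by positivity
  have hrv : r * ‖v‖ ≤ R / 2 := by
    rw [hr_def, div_mul_eq_mul_div, div_le_iff₀ (by positivity)]
    gcongr
    linarith
  have hmem : ∀ y ∈ ball x (R / 2), ∀ z ∈ closedBall (0 : ℂ) r, y + z • v ∈ ball x R := by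
    intro y hy z hz
    rw [mem_ball_iff_norm] at hy ⊢
    rw [mem_closedBall_zero_iff] at hz
    calc ‖y + z • v - x‖ = ‖(y - x) + z • v‖ := by congr 1; abel
      _ ≤ ‖y - x‖ + ‖z‖ * ‖v‖ := (norm_add_le _ _).trans (by rw [norm_smul])
      _ < R / 2 + r * ‖v‖ := add_lt_add_of_lt_of_le hy (by gcongr)
      _ ≤ R := by linarith
  have hcirc : ∀ θ : ℝ, circleMap 0 r θ ∈ closedBall (0 : ℂ) r :=
    fun θ ↦ circleMap_mem_closedBall 0 hr.le θ
  let c : ℝ → ℂ := fun θ ↦ deriv (circleMap 0 r) θ * ((circleMap 0 r θ - 0) ^ 2)⁻¹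
  have hc : Continuous c := by
    simp only [c, deriv_circleMap]
    refine Continuous.mul (by fun_prop) (Continuous.inv₀ (by fun_prop) fun θ ↦ ?_)
    simp [hr.ne']
  have heq : (fun u ↦ fderiv ℂ f u v) =ᶠ[𝓝 x] fun u ↦ (2 * Real.pi * Complex.I : ℂ)⁻¹ •
      ∫ θ in (0 : ℝ)..2 * Real.pi, c θ • f (u + circleMap 0 r θ • v) := by
    filter_upwards [ball_mem_nhds x (half_pos hR)] with y hy
    rw [fderiv_apply_eq_cderiv hU hf hr fun z hz ↦ hRU (hmem y hy z hz)]
    simp only [Complex.cderiv, circleIntegral, c, mul_smul]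
  refine DifferentiableAt.congr_of_eventuallyEq (DifferentiableAt.const_smul ?_ _) heq
  have hcont : ∀ y ∈ ball x (R / 2),
      Continuous fun θ : ℝ ↦ c θ • f (y + circleMap 0 r θ • v) := by
    intro y hy
    refine hc.smul (hf.continuousOn.comp_continuous (by fun_prop) fun θ ↦ ?_)
    exact hRU (hmem y hy _ (hcirc θ))
  have hderiv : ∀ y ∈ ball x (R / 2), ∀ θ : ℝ,
      HasFDerivAt (fun u ↦ c θ • f (u + circleMap 0 r θ • v))
        (c θ • fderiv ℂ f (y + circleMap 0 r θ • v)) y := by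
    intro y hy θ
    have := (hf.differentiableAt (hU.mem_nhds (hRU (hmem y hy _ (hcirc θ))))).hasFDerivAt
    exact ((hasFDerivAt_comp_add_right _).2 this).const_smul (c θ)
  refine (intervalIntegral.hasFDerivAt_integral_of_dominated_of_fderiv_le
    (F' := fun y θ ↦ c θ • fderiv ℂ f (y + circleMap 0 r θ • v))
    (bound := fun θ ↦ ‖c θ‖ * C)
    (ball_mem_nhds x (half_pos hR)) ?_ ?_ ?_ ?_ ?_ ?_).differentiableAt
  · filter_upwards [ball_mem_nhds x (half_pos hR)] with y hy
    exact (hcont y hy).aestronglyMeasurable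
  · exact (hcont x (mem_ball_self (half_pos hR))).intervalIntegrable _ _
  · borelize E
    borelize (E →L[ℂ] F)
    have : SecondCountableTopology (E →L[ℂ] F) := inferInstance
    have hm : Measurable fun θ : ℝ ↦ fderiv ℂ f (x + circleMap 0 r θ • v) :=
      (measurable_fderiv ℂ f).comp (Continuous.measurable (by fun_prop))
    exact hc.aestronglyMeasurable.smul hm.aestronglyMeasurable
  · refine Filter.Eventually.of_forall fun θ _ y hy ↦ ?_
    rw [norm_smul]
    gcongr
    exact hC _ (hmem y hy _ (hcirc θ))
  · exact (hc.norm.mul continuous_const).intervalIntegrable _ _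
  · exact Filter.Eventually.of_forall fun θ _ y hy ↦ hderiv y hy θ

/-- The derivative of a holomorphic map in several variables is holomorphic. -/
theorem differentiableOn_fderiv [FiniteDimensional ℂ E] [FiniteDimensional ℂ F]
    {f : E → F} {U : Set E} (hU : IsOpen U) (hf : DifferentiableOn ℂ f U) :
    DifferentiableOn ℂ (fderiv ℂ f) U := by
  let e₁ := ContinuousLinearEquiv.ofFinrankEq
    (Module.finrank_fin_fun ℂ (n := Module.finrank ℂ E)).symm
  let e₂ := (e₁.arrowCongr (1 : F ≃L[ℂ] F)).trans (ContinuousLinearEquiv.piRing _)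
  rw [← e₂.comp_differentiableOn_iff]
  exact differentiableOn_pi.2 fun i ↦ differentiableOn_fderiv_apply hU hf _

/-- The `1`-form `B Z dY` is differentiable, with exterior derivative `B dZ ∧ dY`. -/
theorem exists_hasFDerivAt_bilin_comp_fderiv [FiniteDimensional ℂ E] [FiniteDimensional ℂ H]
    (B : G →L[ℂ] H →L[ℂ] F) {Z : E → G} {Y : E → H} {U : Set E} (hU : IsOpen U)
    (hZ : DifferentiableOn ℂ Z U) (hY : DifferentiableOn ℂ Y U) {u : E} (hu : u ∈ U) :
    ∃ ω' : E →L[ℂ] E →L[ℂ] F,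
      HasFDerivAt (fun u ↦ (B (Z u)).comp (fderiv ℂ Y u)) ω' u ∧
      ∀ a b, ω' a b - ω' b a =
        B (fderiv ℂ Z u a) (fderiv ℂ Y u b) - B (fderiv ℂ Z u b) (fderiv ℂ Y u a) := by
  have hUu := hU.mem_nhds hu
  have h1 : HasFDerivAt (fun u ↦ B (Z u)) (B.comp (fderiv ℂ Z u)) u :=
    B.hasFDerivAt.comp u (hZ.differentiableAt hUu).hasFDerivAt
  have h2 := ((differentiableOn_fderiv hU hY).differentiableAt hUu).hasFDerivAt
  refine ⟨_, h1.clm_comp h2, fun a b ↦ ?_⟩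
  have hsymm := second_derivative_symmetric_of_eventually (𝕜 := ℂ)
    (Filter.mem_of_superset hUu fun y hy ↦
      (hY.differentiableAt (hU.mem_nhds hy)).hasFDerivAt) h2 a b
  simp [hsymm]

/-- A relation `dX = B Z dY` forces `B dZ ∧ dY = 0`. -/
theorem bilin_fderiv_symm_of_hasFDerivAt [FiniteDimensional ℂ E] [FiniteDimensional ℂ H]
    (B : G →L[ℂ] H →L[ℂ] F) {X : E → F} {Z : E → G} {Y : E → H} {U : Set E} (hU : IsOpen U)
    (hZ : DifferentiableOn ℂ Z U) (hY : DifferentiableOn ℂ Y U)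
    (hX : ∀ u ∈ U, HasFDerivAt X ((B (Z u)).comp (fderiv ℂ Y u)) u) {u : E} (hu : u ∈ U)
    (a b : E) :
    B (fderiv ℂ Z u a) (fderiv ℂ Y u b) = B (fderiv ℂ Z u b) (fderiv ℂ Y u a) := by
  obtain ⟨ω', hω', h⟩ := exists_hasFDerivAt_bilin_comp_fderiv B hU hZ hY hu
  have := second_derivative_symmetric_of_eventually (𝕜 := ℂ)
    (Filter.mem_of_superset (hU.mem_nhds hu) hX) hω' a b
  rw [← sub_eq_zero, ← h, this, sub_self]

/-- If `B dZ ∧ dY = 0` on a convex open set, then `B Z dY` has a primitive with a prescribed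
zero. -/
theorem exists_hasFDerivAt_bilin_of_fderiv_symm [FiniteDimensional ℂ E] [FiniteDimensional ℂ H]
    [NormedSpace ℝ E] [IsScalarTower ℝ ℂ E] [CompleteSpace F]
    (B : G →L[ℂ] H →L[ℂ] F) {Z : E → G} {Y : E → H} {U : Set E} (hU : IsOpen U)
    (hUc : Convex ℝ U) (hZ : DifferentiableOn ℂ Z U) (hY : DifferentiableOn ℂ Y U)
    (hsymm : ∀ u ∈ U, ∀ a b,
      B (fderiv ℂ Z u a) (fderiv ℂ Y u b) = B (fderiv ℂ Z u b) (fderiv ℂ Y u a)) (x₀ : E) :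
    ∃ X : E → F, X x₀ = 0 ∧ ∀ u ∈ U, HasFDerivAt X ((B (Z u)).comp (fderiv ℂ Y u)) u := by
  choose! ω' hω' h using fun u hu ↦ exists_hasFDerivAt_bilin_comp_fderiv B hU hZ hY (u := u) hu
  obtain ⟨X, hX⟩ := hUc.exists_forall_hasFDerivWithinAt_of_hasFDerivWithinAt_symmetric
    (fun u hu ↦ ((hω' u hu).restrictScalars ℝ).hasFDerivWithinAt) fun u hu a _ b _ ↦ by
      simpa [hsymm u hu a b, sub_eq_zero] using h u hu a b
  refine ⟨fun u ↦ X u - X x₀, sub_self _, fun u hu ↦ ?_⟩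
  exact ((hX u hu).hasFDerivAt (hU.mem_nhds hu)).sub_const _

end Holomorphic

/-- Matrix multiplication as a continuous bilinear map. -/
noncomputable def Matrix.mulCLM (p q r : ℕ) :
    Matrix (Fin p) (Fin q) ℂ →L[ℂ] Matrix (Fin q) (Fin r) ℂ →L[ℂ] Matrix (Fin p) (Fin r) ℂ :=
  LinearMap.toContinuousBilinearMap
    (LinearMap.mk₂ ℂ (fun M N ↦ M * N) Matrix.add_mul (fun c M N ↦ Matrix.smul_mul c M N)
      Matrix.mul_add fun c M N ↦ Matrix.mul_smul M c N)

open Classical in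
/-- A primitive on `U`, vanishing at `0`, of the `1`-form `ω`; junk if there is none. -/
noncomputable def primitiveOn {E F : Type*} [NormedAddCommGroup E] [NormedSpace ℂ E]
    [NormedAddCommGroup F] [NormedSpace ℂ F] (U : Set E) (ω : E → E →L[ℂ] F) : E → F :=
  if h : ∃ X : E → F, X 0 = 0 ∧ ∀ u ∈ U, HasFDerivAt X (ω u) u then h.choose else 0

theorem primitiveOn_spec {E F : Type*} [NormedAddCommGroup E] [NormedSpace ℂ E]
    [NormedAddCommGroup F] [NormedSpace ℂ F] {U : Set E} {ω : E → E →L[ℂ] F}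
    (h : ∃ X : E → F, X 0 = 0 ∧ ∀ u ∈ U, HasFDerivAt X (ω u) u) :
    primitiveOn U ω 0 = 0 ∧ ∀ u ∈ U, HasFDerivAt (primitiveOn U ω) (ω u) u := by
  rw [primitiveOn, dif_pos h]
  exact h.choose_spec

section Horizontal

variable {W : ℕ} {m : ℕ → ℕ} {d : ℕ} (U : Set (Fin d → ℂ))
  (Y1 : (j : Fin (W + 2)) → (Fin d → ℂ) → Matrix (Fin (m ((j : ℕ) + 1))) (Fin (m (j : ℕ))) ℂ)
  (Y2 : (j : Fin (W + 1)) → (Fin d → ℂ) → Matrix (Fin (m ((j : ℕ) + 2))) (Fin (m (j : ℕ))) ℂ)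

/-- All blocks `Y_{i,j}` with `j < i`: the given ones if `i - j ≤ 2`, and iterated primitives
of `Y_{i,j+1} dY_{j+1,j}` otherwise. -/
noncomputable def horizontalBlock (i j : ℕ) (h1 : j + 1 ≤ i) (h2 : i ≤ W + 2) :
    (Fin d → ℂ) → Matrix (Fin (m i)) (Fin (m j)) ℂ :=
  if e1 : j + 1 = i then e1 ▸ Y1 ⟨j, by omega⟩
  else if e2 : j + 2 = i then e2 ▸ Y2 ⟨j, by omega⟩
  else primitiveOn U fun u ↦ (Matrix.mulCLM _ _ _
    (horizontalBlock i (j + 1) (by omega) h2 u)).comp (fderiv ℂ (Y1 ⟨j, by omega⟩) u)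
termination_by i - j

theorem horizontalBlock_one (j : ℕ) (h2 : j + 1 ≤ W + 2) :
    horizontalBlock U Y1 Y2 (j + 1) j le_rfl h2 = Y1 ⟨j, by omega⟩ := by
  rw [horizontalBlock, dif_pos rfl]

theorem horizontalBlock_two (j : ℕ) (h2 : j + 2 ≤ W + 2) :
    horizontalBlock U Y1 Y2 (j + 2) j (by omega) h2 = Y2 ⟨j, by omega⟩ := by
  rw [horizontalBlock, dif_neg (by omega), dif_pos rfl]

theorem horizontalBlock_of_three_le {i j : ℕ} (h1 : j + 3 ≤ i) (h2 : i ≤ W + 2) :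
    horizontalBlock U Y1 Y2 i j (by omega) h2 = primitiveOn U fun u ↦ (Matrix.mulCLM _ _ _
      (horizontalBlock U Y1 Y2 i (j + 1) (by omega) h2 u)).comp
        (fderiv ℂ (Y1 ⟨j, by omega⟩) u) := by
  rw [horizontalBlock, dif_neg (by omega), dif_neg (by omega)]

variable {U Y1 Y2}

/-- Along a solution of the coupled contact equations, `dY_{j+2,j+1} ∧ dY_{j+1,j} = 0`. -/
theorem fderiv_mul_fderiv_symm_of_contact (hU : IsOpen U)
    (hY1 : ∀ j, DifferentiableOn ℂ (Y1 j) U) (hY2 : ∀ j, DifferentiableOn ℂ (Y2 j) U)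
    (hcontact : ∀ (j : Fin (W + 1)), ∀ u ∈ U, ∀ v : Fin d → ℂ,
      fderiv ℂ (Y2 j) u v =
        Y1 ⟨(j : ℕ) + 1, by omega⟩ u * fderiv ℂ (Y1 ⟨(j : ℕ), by omega⟩) u v)
    (j : ℕ) (hj : j + 1 < W + 2) {u : Fin d → ℂ} (hu : u ∈ U) (a b : Fin d → ℂ) :
    fderiv ℂ (Y1 ⟨j + 1, hj⟩) u a * fderiv ℂ (Y1 ⟨j, by omega⟩) u b =
      fderiv ℂ (Y1 ⟨j + 1, hj⟩) u b * fderiv ℂ (Y1 ⟨j, by omega⟩) u a := by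
  refine bilin_fderiv_symm_of_hasFDerivAt (Matrix.mulCLM _ _ _) (X := Y2 ⟨j, by omega⟩) hU
    (hY1 ⟨j + 1, hj⟩) (hY1 ⟨j, by omega⟩) (fun x hx ↦ ?_) hu a b
  exact ((hY2 ⟨j, by omega⟩).differentiableAt (hU.mem_nhds hx)).hasFDerivAt.congr_fderiv
    (ContinuousLinearMap.ext (hcontact ⟨j, by omega⟩ x hx))

/-- The blocks `horizontalBlock` are holomorphic, vanish at `0` if `i - j ≥ 3`, and satisfy
`dY_{i,j} = Y_{i,j+1} dY_{j+1,j}` if `i - j ≥ 2`. -/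
theorem horizontalBlock_spec (hU : IsOpen U) (hUconv : Convex ℝ U)
    (hY1 : ∀ j, DifferentiableOn ℂ (Y1 j) U) (hY2 : ∀ j, DifferentiableOn ℂ (Y2 j) U)
    (hcontact : ∀ (j : Fin (W + 1)), ∀ u ∈ U, ∀ v : Fin d → ℂ,
      fderiv ℂ (Y2 j) u v =
        Y1 ⟨(j : ℕ) + 1, by omega⟩ u * fderiv ℂ (Y1 ⟨(j : ℕ), by omega⟩) u v)
    (i j : ℕ) (h1 : j + 1 ≤ i) (h2 : i ≤ W + 2) :
    DifferentiableOn ℂ (horizontalBlock U Y1 Y2 i j h1 h2) U ∧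
    (j + 3 ≤ i → horizontalBlock U Y1 Y2 i j h1 h2 0 = 0) ∧
    ∀ h : j + 2 ≤ i, ∀ u ∈ U, ∀ v, fderiv ℂ (horizontalBlock U Y1 Y2 i j h1 h2) u v =
      horizontalBlock U Y1 Y2 i (j + 1) h h2 u * fderiv ℂ (Y1 ⟨j, by omega⟩) u v := by
  obtain rfl | h3 := h1.eq_or_lt
  · refine ⟨?_, by omega, by omega⟩
    rw [horizontalBlock_one]
    exact hY1 _
  obtain rfl | h4 := (show j + 2 ≤ i from h3).eq_or_lt
  · refine ⟨?_, by omega, fun _ u hu v ↦ ?_⟩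
    · rw [horizontalBlock_two]
      exact hY2 _
    · have := horizontalBlock_one U Y1 Y2 (j + 1) h2
      rw [horizontalBlock_two, this]
      exact hcontact ⟨j, by omega⟩ u hu v
  obtain ⟨hd, -, hf⟩ :=
    horizontalBlock_spec hU hUconv hY1 hY2 hcontact i (j + 1) (by omega) h2
  obtain ⟨h0, hX⟩ := primitiveOn_spec (exists_hasFDerivAt_bilin_of_fderiv_symm
    (Matrix.mulCLM _ _ _) hU hUconv hd (hY1 ⟨j, by omega⟩) (fun u hu a b ↦ by
      change fderiv ℂ (horizontalBlock U Y1 Y2 i (j + 1) _ h2) u a *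
          fderiv ℂ (Y1 ⟨j, by omega⟩) u b =
        fderiv ℂ (horizontalBlock U Y1 Y2 i (j + 1) _ h2) u b * fderiv ℂ (Y1 ⟨j, by omega⟩) u a
      rw [hf h4 u hu, hf h4 u hu, Matrix.mul_assoc, Matrix.mul_assoc]
      exact congrArg _ (fderiv_mul_fderiv_symm_of_contact hU hY1 hY2 hcontact j (by omega)
        hu a b)) 0)
  rw [horizontalBlock_of_three_le U Y1 Y2 h4 h2]
  exact ⟨fun u hu ↦ (hX u hu).differentiableAt.differentiableWithinAt, fun _ ↦ h0,
    fun _ u hu v ↦ DFunLike.congr_fun (hX u hu).fderiv v⟩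
termination_by i - j

/-- Any two horizontal extensions of the same data agree on `U`. -/
theorem IsHorizontalExtension.eqOn (hU : IsOpen U) (hUconv : Convex ℝ U)
    (h0U : (0 : Fin d → ℂ) ∈ U)
    {Yf Yf' : (i j : ℕ) → j + 3 ≤ i → i ≤ W + 2 →
      (Fin d → ℂ) → Matrix (Fin (m i)) (Fin (m j)) ℂ}
    (h : IsHorizontalExtension W m U Y1 Y2 Yf) (h' : IsHorizontalExtension W m U Y1 Y2 Yf')
    (i j : ℕ) (h1 : j + 3 ≤ i) (h2 : i ≤ W + 2) :
    Set.EqOn (Yf i j h1 h2) (Yf' i j h1 h2) U := by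
  refine hU.eqOn_of_fderiv_eq hUconv.isPreconnected (h.1 i j h1 h2) (h'.1 i j h1 h2)
    (fun u hu ↦ ?_) h0U ((h.2.1 i j h1 h2).trans (h'.2.1 i j h1 h2).symm)
  ext1 v
  obtain rfl | h3 := h1.eq_or_lt
  · exact (h.2.2.1 j h2 u hu v).trans (h'.2.2.1 j h2 u hu v).symm
  · refine (h.2.2.2 i j h3 h2 u hu v).trans (.trans ?_ (h'.2.2.2 i j h3 h2 u hu v).symm)
    rw [IsHorizontalExtension.eqOn hU hUconv h0U h h' i (j + 1) (by omega) h2 hu]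
termination_by i - j

end Horizontal

/-- Every germ of an integral manifold of the coupled contact system extends
uniquely to a germ of an integral manifold of Griffiths' horizontal system:
given a holomorphic solution `(Y1, Y2)` of the coupled contact equations
`dY_{j+2,j} = Y_{j+2,j+1} dY_{j+1,j}` on a convex open neighborhood `U` of `0`,
there is a unique family `Y_{i,j}` (`i − j ≥ 3`) of holomorphic matrix-valued
maps with `Y_{i,j}(0) = 0` solving `dY_{i,j} = Y_{i,j+1} dY_{j+1,j}`. -/
theorem stmt_7 (W : ℕ) (m : ℕ → ℕ) (d : ℕ) (hd : 1 ≤ d)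
    (U : Set (Fin d → ℂ)) (hU : IsOpen U) (hUconv : Convex ℝ U)
    (h0U : (0 : Fin d → ℂ) ∈ U)
    (Y1 : (j : Fin (W + 2)) → (Fin d → ℂ) → Matrix (Fin (m ((j : ℕ) + 1))) (Fin (m (j : ℕ))) ℂ)
    (Y2 : (j : Fin (W + 1)) → (Fin d → ℂ) → Matrix (Fin (m ((j : ℕ) + 2))) (Fin (m (j : ℕ))) ℂ)
    (hY1 : ∀ j, DifferentiableOn ℂ (Y1 j) U)
    (hY2 : ∀ j, DifferentiableOn ℂ (Y2 j) U)
    (hcontact : ∀ (j : Fin (W + 1)), ∀ u ∈ U, ∀ v : Fin d → ℂ,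
      fderiv ℂ (Y2 j) u v =
        Y1 ⟨(j : ℕ) + 1, by omega⟩ u * fderiv ℂ (Y1 ⟨(j : ℕ), by omega⟩) u v) :
    ∃ Yf : (i j : ℕ) → j + 3 ≤ i → i ≤ W + 2 →
        (Fin d → ℂ) → Matrix (Fin (m i)) (Fin (m j)) ℂ,
      IsHorizontalExtension W m U Y1 Y2 Yf ∧
      ∀ Yf' : (i j : ℕ) → j + 3 ≤ i → i ≤ W + 2 →
          (Fin d → ℂ) → Matrix (Fin (m i)) (Fin (m j)) ℂ,
        IsHorizontalExtension W m U Y1 Y2 Yf' →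
        ∀ i j h1 h2, Set.EqOn (Yf i j h1 h2) (Yf' i j h1 h2) U := by
  have key := horizontalBlock_spec hU hUconv hY1 hY2 hcontact
  have hext : IsHorizontalExtension W m U Y1 Y2
      fun i j h1 h2 ↦ horizontalBlock U Y1 Y2 i j (by omega) h2 := by
    refine ⟨fun i j h1 h2 ↦ (key i j _ h2).1, fun i j h1 h2 ↦ (key i j _ h2).2.1 h1,
      fun j h u hu v ↦ ?_, fun i j h1 h2 u hu v ↦ (key i j _ h2).2.2 (by omega) u hu v⟩
    have := horizontalBlock_two U Y1 Y2 (j + 1) h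
    rw [(key _ j _ h).2.2 (by omega) u hu v, this]
  exact ⟨_, hext, fun _ h' ↦ hext.eqOn hU hUconv h0U h'⟩
end

section
/- Let p, q ≥ 1 and let E be a ℂ-linear subspace of Matrix (Fin p) (Fin q) ℂ such that Xᵀ * Y = Yᵀ * X for all X, Y ∈ E. Then finrank ℂ E ≤ q̄(p, q), where q̄(p, q) := p if q = 1; q̄(p, q) := p·q/2 if q > 1 and p is even; and q̄(p, q) := q·(p−1)/2 + 1 if q > 1 and p is odd. (This is the bound on integral elements of the horizontal distribution — infinitesimal variations of Hodge structure — in weight two, with p = h^{1,1} and q = h^{2,0}.) -/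
open Matrix

section AbelianSubspace

open Module LinearMap.BilinForm

variable {K V : Type*} [Field K] [AddCommGroup V] [Module K V] {B : LinearMap.BilinForm K V}

theorem map_proj_zero_le {q : ℕ} (W : Submodule K V) (E : Submodule K (Fin (q + 1) → V))
    (hW : ∀ X ∈ E, ∀ i, X i ∈ W) :
    E.map (LinearMap.proj (R := K) (φ := fun _ => V) 0) ≤ W := by
  rintro _ ⟨X, hX, rfl⟩
  exact hW X hX 0

theorem tail_mem_inf_orthogonal (hB₀ : B.IsRefl) {q : ℕ} (W : Submodule K V)
    (E : Submodule K (Fin (q + 1) → V)) (hW : ∀ X ∈ E, ∀ i, X i ∈ W)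
    (hE : ∀ X ∈ E, ∀ Y ∈ E, ∀ i j, B (X i) (Y j) = B (Y i) (X j)) {X : Fin q → V}
    (hX : X ∈ E.comap (LinearMap.vecCons (0 : (Fin q → V) →ₗ[K] V) LinearMap.id)) (i : Fin q) :
    X i ∈ W ⊓ B.orthogonal (E.map (LinearMap.proj (R := K) (φ := fun _ => V) 0)) := by
  refine ⟨by simpa using hW _ hX i.succ, ?_⟩
  rintro _ ⟨Y, hY, rfl⟩
  exact hB₀ _ _ (by simpa using hE _ hX _ hY i.succ 0)

variable [FiniteDimensional K V]

/-- Splitting off the first coordinate of a subspace of `Fin (q + 1) → V`. -/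
theorem finrank_le_finrank_map_proj_zero_add {q : ℕ} (E : Submodule K (Fin (q + 1) → V)) :
    finrank K E ≤ finrank K (E.map (LinearMap.proj (R := K) (φ := fun _ => V) 0)) +
      finrank K (E.comap (LinearMap.vecCons (0 : (Fin q → V) →ₗ[K] V) LinearMap.id)) := by
  set π := LinearMap.proj (R := K) (φ := fun _ : Fin (q + 1) => V) 0
  have h := LinearMap.finrank_range_add_finrank_ker (π.domRestrict E)
  rw [LinearMap.range_domRestrict] at h
  rw [← h]
  gcongr
  set ι := LinearMap.vecCons (0 : (Fin q → V) →ₗ[K] V) LinearMap.id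
  have hle : (LinearMap.ker (π.domRestrict E)).map E.subtype ≤ (E.comap ι).map ι := by
    rintro _ ⟨⟨x, hx⟩, hx0, rfl⟩
    have hx0' : x 0 = 0 := hx0
    have hcons : ι (fun i => x i.succ) = x := by
      ext i
      refine Fin.cases ?_ (fun j => ?_) i
      · simpa [ι] using hx0'.symm
      · simp [ι]
    exact ⟨fun i => x i.succ, by simpa [hcons] using hx, hcons⟩
  calc finrank K (LinearMap.ker (π.domRestrict E))
      = finrank K ((LinearMap.ker (π.domRestrict E)).map E.subtype) :=
        (Submodule.finrank_map_subtype_eq _ _).symm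
    _ ≤ finrank K ((E.comap ι).map ι) := Submodule.finrank_mono hle
    _ ≤ finrank K (E.comap ι) := Submodule.finrank_map_le _ _

theorem orthogonal_orthogonal_sup (hB : B.Nondegenerate) (hB₀ : B.IsRefl) (U W : Submodule K V) :
    B.orthogonal (B.orthogonal W ⊔ U) = W ⊓ B.orthogonal U := by
  conv_rhs => rw [← orthogonal_orthogonal hB hB₀ W]
  refine le_antisymm (le_inf (orthogonal_le le_sup_left) (orthogonal_le le_sup_right)) ?_
  rintro x ⟨hx₁, hx₂⟩ y hy
  obtain ⟨u, hu, v, hv, rfl⟩ := Submodule.mem_sup.1 hy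
  have h₁ : B u x = 0 := hx₁ u hu
  have h₂ : B v x = 0 := hx₂ v hv
  simp [h₁, h₂]

theorem finrank_add_finrank_inf_orthogonal (hB : B.Nondegenerate) (hB₀ : B.IsRefl)
    (U W : Submodule K V) :
    finrank K U + finrank K (W ⊓ B.orthogonal U : Submodule K V) =
      finrank K W + finrank K (B.orthogonal W ⊓ U : Submodule K V) := by
  have h1 := Submodule.finrank_sup_add_finrank_inf_eq (B.orthogonal W) U
  have h2 := finrank_orthogonal hB (B.orthogonal W ⊔ U)
  rw [orthogonal_orthogonal_sup hB hB₀] at h2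
  have h3 := finrank_orthogonal hB W
  have h4 := Submodule.finrank_le W
  have h5 := Submodule.finrank_le (B.orthogonal W ⊔ U)
  lia

theorem finrank_add_finrank_inf_orthogonal_le (hB : B.Nondegenerate) (hB₀ : B.IsRefl)
    {U W : Submodule K V} (hUW : U ≤ W) :
    finrank K U + finrank K (W ⊓ B.orthogonal U : Submodule K V) ≤
      finrank K W + finrank K (W ⊓ B.orthogonal W : Submodule K V) := by
  rw [finrank_add_finrank_inf_orthogonal hB hB₀]
  gcongr
  exact Submodule.finrank_mono (le_inf (inf_le_right.trans hUW) inf_le_left)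

/-- The sum of the dimension of a subspace and that of its radical does not increase when
passing to `W ⊓ Uᗮ` with `U ≤ W`. -/
theorem finrank_add_finrank_radical_inf_orthogonal_le (hB : B.Nondegenerate) (hB₀ : B.IsRefl)
    {U W : Submodule K V} (hUW : U ≤ W) :
    finrank K (W ⊓ B.orthogonal U : Submodule K V) +
        finrank K ((W ⊓ B.orthogonal U) ⊓ B.orthogonal (W ⊓ B.orthogonal U) : Submodule K V) ≤
      finrank K W + finrank K (W ⊓ B.orthogonal W : Submodule K V) := by
  have h1 := finrank_add_finrank_inf_orthogonal hB hB₀ U W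
  have h2 : (W ⊓ B.orthogonal U) ⊓ B.orthogonal (W ⊓ B.orthogonal U) ≤
      U ⊔ B.orthogonal W ⊓ W := by
    conv_lhs => rw [← orthogonal_orthogonal_sup hB hB₀ U W]
    rw [orthogonal_orthogonal hB hB₀, orthogonal_orthogonal_sup hB hB₀, inf_comm,
      ← sup_inf_assoc_of_le _ hUW, sup_comm]
    exact inf_le_inf_left _ inf_le_left
  have h3 := Submodule.finrank_sup_add_finrank_inf_eq U (B.orthogonal W ⊓ W)
  have h4 : U ⊓ (B.orthogonal W ⊓ W) = B.orthogonal W ⊓ U := by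
    rw [inf_left_comm, inf_eq_left.2 hUW]
  rw [h4] at h3
  have h5 := Submodule.finrank_mono h2
  rw [inf_comm W (B.orthogonal W)]
  lia

theorem add_div_two_mul_add_mod_two_le {q r n t t' : ℕ} (hq : 2 ≤ q) (htt : t' ≤ t)
    (htn : t' ≤ 2 * n) (hrn : r + n ≤ t) :
    r + (t' / 2 * q + t' % 2) ≤ t / 2 * (q + 1) + t % 2 := by
  obtain ⟨k, rfl⟩ := Nat.exists_eq_add_of_le hq
  rcases le_or_gt r (t / 2) with hr | hr
  · rcases (Nat.div_le_div_right (c := 2) htt).eq_or_lt with h | h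
    · rw [h, mul_add_one]
      lia
    · have := Nat.mul_le_mul_right (2 + k) (Nat.succ_le_of_lt h)
      rw [Nat.succ_mul] at this
      rw [mul_add_one]
      lia
  · have hn : n ≤ t / 2 := by lia
    have h1 : t' / 2 * (2 + k) + t' % 2 ≤ n * (2 + k) := by
      rcases (show t' / 2 ≤ n by lia).eq_or_lt with h | h
      · rw [h]
        lia
      · have := Nat.mul_le_mul_right (2 + k) (Nat.succ_le_of_lt h)
        rw [Nat.succ_mul] at this
        lia
    have h2 := Nat.mul_le_mul_right (1 + k) hn
    grind

/-- A subspace `E` of `Fin q → W` on which `B (X i) (Y j) = B (Y i) (X j)` holds identically has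
dimension at most `⌊t / 2⌋ * q + t % 2`, where `t` is the sum of the dimensions of `W` and of its
radical. -/
theorem finrank_le_of_apply_eq_swap (hB : B.Nondegenerate) (hB₀ : B.IsRefl) {q : ℕ} (hq : 2 ≤ q)
    (W : Submodule K V) (E : Submodule K (Fin q → V)) (hW : ∀ X ∈ E, ∀ i, X i ∈ W)
    (hE : ∀ X ∈ E, ∀ Y ∈ E, ∀ i j, B (X i) (Y j) = B (Y i) (X j)) :
    finrank K E ≤
      (finrank K W + finrank K (W ⊓ B.orthogonal W : Submodule K V)) / 2 * q +
        (finrank K W + finrank K (W ⊓ B.orthogonal W : Submodule K V)) % 2 := by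
  induction q, hq using Nat.le_induction generalizing W with
  | base =>
    refine (finrank_le_finrank_map_proj_zero_add E).trans ?_
    have hU := map_proj_zero_le W E hW
    have hE₁ := fun X hX => tail_mem_inf_orthogonal hB₀ W E hW hE (X := X) hX
    set U := E.map (LinearMap.proj (R := K) (φ := fun _ => V) 0)
    set E₁ := E.comap (LinearMap.vecCons (0 : (Fin 1 → V) →ₗ[K] V) LinearMap.id)
    have h1 := finrank_add_finrank_inf_orthogonal_le hB hB₀ hU
    have h2 : finrank K E₁ ≤ finrank K (W ⊓ B.orthogonal U : Submodule K V) := by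
      refine (Submodule.finrank_mono fun X hX => ?_).trans
        (Submodule.finrank_map_le (LinearEquiv.funUnique (Fin 1) K V).symm.toLinearMap _)
      exact ⟨X 0, hE₁ X hX 0, (LinearEquiv.funUnique (Fin 1) K V).symm_apply_apply X⟩
    lia
  | succ q hq ih =>
    refine (finrank_le_finrank_map_proj_zero_add E).trans ?_
    have hU := map_proj_zero_le W E hW
    have hE₁ := fun X hX => tail_mem_inf_orthogonal hB₀ W E hW hE (X := X) hX
    set U := E.map (LinearMap.proj (R := K) (φ := fun _ => V) 0)
    refine (Nat.add_le_add_left (ih (W ⊓ B.orthogonal U) _ hE₁ fun X hX Y hY i j => ?_) _).trans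
      (add_div_two_mul_add_mod_two_le (n := finrank K (W ⊓ B.orthogonal U : Submodule K V)) hq
        (finrank_add_finrank_radical_inf_orthogonal_le hB hB₀ hU) ?_
        (finrank_add_finrank_inf_orthogonal_le hB hB₀ hU))
    · simpa using hE _ hX _ hY i.succ j.succ
    · have := Submodule.finrank_mono (inf_le_left : (W ⊓ B.orthogonal U) ⊓
        B.orthogonal (W ⊓ B.orthogonal U) ≤ W ⊓ B.orthogonal U)
      lia

end AbelianSubspace

/-- Carlson's bound on integral elements of the horizontal distribution in weight
two: an abelian subspace `E` of `p × q` matrices (i.e. `Xᵀ Y = Yᵀ X` for all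
`X, Y ∈ E`) has dimension at most `q̄(p,q)`, where `q̄(p,q) = p` if `q = 1`,
`q̄(p,q) = pq/2` if `q > 1` and `p` is even, and `q̄(p,q) = q(p−1)/2 + 1` if
`q > 1` and `p` is odd. -/
theorem stmt_8 (p q : ℕ) (hp : 1 ≤ p) (hq : 1 ≤ q)
    (E : Submodule ℂ (Matrix (Fin p) (Fin q) ℂ))
    (habel : ∀ X ∈ E, ∀ Y ∈ E, Xᵀ * Y = Yᵀ * X) :
    Module.finrank ℂ E ≤
      if q = 1 then p
      else if Even p then p * q / 2
      else q * (p - 1) / 2 + 1 := by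
  let B : LinearMap.BilinForm ℂ (Fin p → ℂ) := Matrix.toBilin' 1
  have hBapp (x y : Fin p → ℂ) : B x y = x ⬝ᵥ y := by simp [B, Matrix.toBilin'_apply']
  have hB : B.Nondegenerate :=
    (Matrix.nondegenerate_of_det_ne_zero (by simp : (1 : Matrix (Fin p) (Fin p) ℂ).det ≠ 0)).toBilin'
  have hB₀ : B.IsRefl := fun x y h => by rw [hBapp, dotProduct_comm, ← hBapp, h]
  split_ifs with h1 h2
  · subst h1
    simpa [Module.finrank_matrix] using Submodule.finrank_le E
  all_goals
    let T : Matrix (Fin p) (Fin q) ℂ ≃ₗ[ℂ] (Fin q → Fin p → ℂ) :=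
      Matrix.transposeLinearEquiv (Fin p) (Fin q) ℂ ℂ
    have key := finrank_le_of_apply_eq_swap hB hB₀ (q := q) (by lia) ⊤ (E.map T.toLinearMap)
      (by simp) (by
        rintro _ ⟨X, hX, rfl⟩ _ ⟨Y, hY, rfl⟩ i j
        rw [hBapp, hBapp]
        exact congrFun₂ (habel X hX Y hY) i j)
    rw [T.finrank_map_eq E, LinearMap.BilinForm.orthogonal_top_eq_bot hB, inf_bot_eq,
      finrank_bot, finrank_top, Module.finrank_fin_fun, add_zero] at key
    refine key.trans ?_
  · obtain ⟨k, rfl⟩ := h2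
    rw [← two_mul, mul_assoc]
    simp
  · obtain ⟨k, rfl⟩ := Nat.not_even_iff_odd.1 h2
    have h3 : (2 * k + 1) / 2 = k := by lia
    have h4 : q * (2 * k + 1 - 1) / 2 = k * q := by
      rw [Nat.add_sub_cancel, mul_left_comm, Nat.mul_div_cancel_left _ two_pos, mul_comm]
    rw [h3, h4]
    lia
end
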